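/- There exist a metric space X, a skew-evolution semiflow C = (φ,Φ) on X × ℝ² (with ℝ² normed by ‖(v₁,v₂)‖ = |v₁| + |v₂|), and projectors P₁, P₂ compatible with C, such that C is polynomially dichotomic with respect to P₁, P₂, but for every choice of constants N ≥ 1 and α₁, α₂, β₁, β₂ > 0 the Barreira–Valls polynomial dichotomy estimates with respect to P₁, P₂ fail; that is, C is not Barreira–Valls polynomially dichotomic with respect to P₁, P₂. -/

import Mathlib

open Real MeasureTheory

section SkewEvolution

variable {X : Type*} [MetricSpace X] {V : Type*} [NormedAddCommGroup V] [NormedSpace ℝ V]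

/-- `φ : T × X → X` is an evolution semiflow (`φ t s x` for `t ≥ s ≥ 0`). -/
def IsEvolutionSemiflow (φ : ℝ → ℝ → X → X) : Prop :=
  (∀ t x, 0 ≤ t → φ t t x = x) ∧
  ∀ t s t₀ x, 0 ≤ t₀ → t₀ ≤ s → s ≤ t → φ t s (φ s t₀ x) = φ t t₀ x

/-- `Φ : T × X → B(V)` is an evolution cocycle over the evolution semiflow `φ`. -/
def IsEvolutionCocycle (φ : ℝ → ℝ → X → X) (Φ : ℝ → ℝ → X → (V →L[ℝ] V)) : Prop :=
  (∀ t x, 0 ≤ t → Φ t t x = ContinuousLinearMap.id ℝ V) ∧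
  ∀ t s t₀ x, 0 ≤ t₀ → t₀ ≤ s → s ≤ t →
    (Φ t s (φ s t₀ x)).comp (Φ s t₀ x) = Φ t t₀ x

/-- `C = (φ, Φ)` is a skew-evolution semiflow on `X × V`. -/
def IsSkewEvolutionSemiflow (φ : ℝ → ℝ → X → X) (Φ : ℝ → ℝ → X → (V →L[ℝ] V)) : Prop :=
  IsEvolutionSemiflow φ ∧ IsEvolutionCocycle φ Φ

/-- A projector on `X × V`: each `P x` is a bounded linear projection and
`(x, v) ↦ P x v` is continuous. -/
def IsProjector (P : X → (V →L[ℝ] V)) : Prop :=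
  (∀ x, (P x).comp (P x) = P x) ∧ Continuous fun p : X × V => P p.1 p.2

/-- A projector invariant relative to the skew-evolution semiflow `C = (φ, Φ)`. -/
def IsInvariantProjector (φ : ℝ → ℝ → X → X) (Φ : ℝ → ℝ → X → (V →L[ℝ] V))
    (P : X → (V →L[ℝ] V)) : Prop :=
  IsProjector P ∧
  ∀ t s x, 0 ≤ s → s ≤ t → (P (φ t s x)).comp (Φ t s x) = (Φ t s x).comp (P x)

/-- Projectors `P₁, P₂` compatible with `C = (φ, Φ)`: `P₂ x = I - P₁ x` and both
are invariant relative to `C`. -/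
def CompatibleProjectors (φ : ℝ → ℝ → X → X) (Φ : ℝ → ℝ → X → (V →L[ℝ] V))
    (P₁ P₂ : X → (V →L[ℝ] V)) : Prop :=
  (∀ x, P₂ x = ContinuousLinearMap.id ℝ V - P₁ x) ∧
  IsInvariantProjector φ Φ P₁ ∧ IsInvariantProjector φ Φ P₂

/-- `C` has exponential growth. -/
def HasExpGrowth (Φ : ℝ → ℝ → X → (V →L[ℝ] V)) : Prop :=
  ∃ M ω : ℝ → ℝ, (∀ s, 0 ≤ s → 0 < M s) ∧ (∀ s, 0 ≤ s → 0 < ω s) ∧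
    ∀ t s t₀ (x : X) (v : V), 0 ≤ t₀ → t₀ ≤ s → s ≤ t →
      ‖Φ t t₀ x v‖ ≤ M s * Real.exp (ω s * (t - s)) * ‖Φ s t₀ x v‖

/-- `C` has exponential decay. -/
def HasExpDecay (Φ : ℝ → ℝ → X → (V →L[ℝ] V)) : Prop :=
  ∃ M ω : ℝ → ℝ, (∀ t, 0 ≤ t → 0 < M t) ∧ (∀ t, 0 ≤ t → 0 < ω t) ∧
    ∀ t s t₀ (x : X) (v : V), 0 ≤ t₀ → t₀ ≤ s → s ≤ t →
      ‖Φ s t₀ x v‖ ≤ M t * Real.exp (ω t * (t - s)) * ‖Φ t t₀ x v‖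

/-- `C` has bounded exponential growth. -/
def HasBoundedExpGrowth (Φ : ℝ → ℝ → X → (V →L[ℝ] V)) : Prop :=
  ∃ M ω : ℝ, 1 ≤ M ∧ 0 < ω ∧
    ∀ t s (x : X), 0 ≤ s → s ≤ t → ‖Φ t s x‖ ≤ M * Real.exp (ω * (t - s))

/-- `C` has uniform exponential decay. -/
def HasUnifExpDecay (Φ : ℝ → ℝ → X → (V →L[ℝ] V)) : Prop :=
  ∃ M ω : ℝ, 1 ≤ M ∧ 0 < ω ∧
    ∀ t s t₀ (x : X) (v : V), 0 ≤ t₀ → t₀ ≤ s → s ≤ t →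
      ‖Φ s t₀ x v‖ ≤ M * Real.exp (ω * (t - s)) * ‖Φ t t₀ x v‖

/-- `C` is strongly measurable: `s ↦ ‖Φ(s, t₀, x) v‖` is measurable on `[t₀, ∞)`. -/
def IsStronglyMeasurableSES (Φ : ℝ → ℝ → X → (V →L[ℝ] V)) : Prop :=
  ∀ t₀ (x : X) (v : V), 0 ≤ t₀ →
    Measurable fun s : Set.Ici t₀ => ‖Φ (s : ℝ) t₀ x v‖

/-- Uniform exponential dichotomy with respect to compatible projectors `P₁, P₂`. -/
def IsUnifExpDichotomic (Φ : ℝ → ℝ → X → (V →L[ℝ] V))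
    (P₁ P₂ : X → (V →L[ℝ] V)) : Prop :=
  ∃ N₁ N₂ ν₁ ν₂ : ℝ, 1 ≤ N₁ ∧ 1 ≤ N₂ ∧ 0 < ν₁ ∧ 0 < ν₂ ∧
    ∀ t s t₀ (x : X) (v : V), 0 ≤ t₀ → t₀ ≤ s → s ≤ t →
      Real.exp (ν₁ * (t - s)) * ‖Φ t t₀ x (P₁ x v)‖ ≤ N₁ * ‖Φ s t₀ x (P₁ x v)‖ ∧
      Real.exp (ν₂ * (t - s)) * ‖Φ s t₀ x (P₂ x v)‖ ≤ N₂ * ‖Φ t t₀ x (P₂ x v)‖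

/-- Barreira-Valls exponential dichotomy with respect to compatible projectors `P₁, P₂`. -/
def IsBVExpDichotomic (Φ : ℝ → ℝ → X → (V →L[ℝ] V))
    (P₁ P₂ : X → (V →L[ℝ] V)) : Prop :=
  ∃ N α₁ α₂ β₁ β₂ : ℝ, 1 ≤ N ∧ 0 < α₁ ∧ 0 < α₂ ∧ 0 < β₁ ∧ 0 < β₂ ∧
    ∀ t s t₀ (x : X) (v : V), 0 ≤ t₀ → t₀ ≤ s → s ≤ t →
      ‖Φ t t₀ x (P₁ x v)‖ ≤ N * Real.exp (-α₁ * t) * Real.exp (β₁ * s) * ‖Φ s t₀ x (P₁ x v)‖ ∧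
      ‖Φ s t₀ x (P₂ x v)‖ ≤ N * Real.exp (-α₂ * t) * Real.exp (β₂ * s) * ‖Φ t t₀ x (P₂ x v)‖

/-- (Nonuniform) exponential dichotomy with respect to compatible projectors `P₁, P₂`. -/
def IsExpDichotomic (Φ : ℝ → ℝ → X → (V →L[ℝ] V))
    (P₁ P₂ : X → (V →L[ℝ] V)) : Prop :=
  ∃ (N₁ N₂ : ℝ → ℝ) (ν₁ ν₂ : ℝ), (∀ s, 0 ≤ s → 0 < N₁ s) ∧ (∀ s, 0 ≤ s → 0 < N₂ s) ∧
    0 < ν₁ ∧ 0 < ν₂ ∧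
    ∀ t s t₀ (x : X) (v : V), 0 ≤ t₀ → t₀ ≤ s → s ≤ t →
      ‖Φ t t₀ x (P₁ x v)‖ ≤ N₁ s * Real.exp (-ν₁ * t) * ‖Φ s t₀ x (P₁ x v)‖ ∧
      ‖Φ s t₀ x (P₂ x v)‖ ≤ N₂ s * Real.exp (-ν₂ * t) * ‖Φ t t₀ x (P₂ x v)‖

/-- Uniform polynomial dichotomy with respect to compatible projectors `P₁, P₂`. -/
def IsUnifPolyDichotomic (Φ : ℝ → ℝ → X → (V →L[ℝ] V))
    (P₁ P₂ : X → (V →L[ℝ] V)) : Prop :=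
  ∃ N α₁ α₂ : ℝ, 1 ≤ N ∧ 0 < α₁ ∧ 0 < α₂ ∧
    ∀ t s (x : X) (v : V), 1 ≤ s → s ≤ t →
      ‖Φ t s x (P₁ x v)‖ ≤ N * t ^ (-α₁) * s ^ α₁ * ‖P₁ x v‖ ∧
      ‖P₂ x v‖ ≤ N * t ^ (-α₂) * s ^ α₂ * ‖Φ t s x (P₂ x v)‖

/-- Barreira-Valls polynomial dichotomy with respect to compatible projectors `P₁, P₂`. -/
def IsBVPolyDichotomic (Φ : ℝ → ℝ → X → (V →L[ℝ] V))
    (P₁ P₂ : X → (V →L[ℝ] V)) : Prop :=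
  ∃ N α₁ α₂ β₁ β₂ : ℝ, 1 ≤ N ∧ 0 < α₁ ∧ 0 < α₂ ∧ 0 < β₁ ∧ 0 < β₂ ∧
    ∀ t s (x : X) (v : V), 1 ≤ s → s ≤ t →
      ‖Φ t s x (P₁ x v)‖ ≤ N * t ^ (-α₁) * s ^ β₁ * ‖P₁ x v‖ ∧
      ‖P₂ x v‖ ≤ N * t ^ (-α₂) * s ^ β₂ * ‖Φ t s x (P₂ x v)‖

/-- (Nonuniform) polynomial dichotomy with respect to compatible projectors `P₁, P₂`. -/
def IsPolyDichotomic (Φ : ℝ → ℝ → X → (V →L[ℝ] V))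
    (P₁ P₂ : X → (V →L[ℝ] V)) : Prop :=
  ∃ (N : ℝ → ℝ) (α₁ α₂ : ℝ), (∀ s, 0 ≤ s → 1 ≤ N s) ∧ 0 < α₁ ∧ 0 < α₂ ∧
    ∀ t s (x : X) (v : V), 1 ≤ s → s ≤ t →
      ‖Φ t s x (P₁ x v)‖ ≤ N s * t ^ (-α₁) * ‖P₁ x v‖ ∧
      ‖P₂ x v‖ ≤ N s * t ^ (-α₂) * ‖Φ t s x (P₂ x v)‖

end SkewEvolution

/-- The diagonal operator on `ℝ²`. -/
noncomputable def diagOp (a b : ℝ) : WithLp 1 (ℝ × ℝ) →L[ℝ] WithLp 1 (ℝ × ℝ) :=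
  LinearMap.toContinuousLinearMap
    { toFun := fun v => WithLp.toLp 1 (a * v.fst, b * v.snd)
      map_add' := by
        intro x y
        apply (WithLp.ofLp_injective 1)
        ext <;> simp [mul_add]
      map_smul' := by
        intro c x
        apply (WithLp.ofLp_injective 1)
        ext <;> simp [mul_left_comm] }

lemma diagOp_apply (a b : ℝ) (v : WithLp 1 (ℝ × ℝ)) :
    diagOp a b v = WithLp.toLp 1 (a * v.fst, b * v.snd) := rfl

lemma diagOp_comp (a b c d : ℝ) :
    (diagOp a b).comp (diagOp c d) = diagOp (a * c) (b * d) := by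
  ext v <;> simp [diagOp_apply, mul_assoc]

lemma diagOp_one : diagOp 1 1 = ContinuousLinearMap.id ℝ _ := by
  ext v : 1
  apply (WithLp.ofLp_injective 1)
  ext <;> simp [diagOp_apply]

lemma diagOp_sub : diagOp 0 1 = ContinuousLinearMap.id ℝ _ - diagOp 1 0 := by
  ext v : 1
  apply (WithLp.ofLp_injective 1)
  ext <;> simp [diagOp_apply]

lemma norm_diagOp (a b : ℝ) (v : WithLp 1 (ℝ × ℝ)) :
    ‖diagOp a b v‖ = |a| * |v.fst| + |b| * |v.snd| := by
  rw [diagOp_apply, WithLp.prod_norm_eq_of_L1]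
  simp [abs_mul]

/-- The weight function. -/
noncomputable def wt (t : ℝ) : ℝ := Real.exp (-(t * (1 - Real.cos t))) / (t ^ 2 + 1)

lemma wt_pos (t : ℝ) : 0 < wt t := by unfold wt; positivity

lemma wt_le (t : ℝ) (ht : 0 ≤ t) : wt t ≤ 1 / (t ^ 2 + 1) := by
  unfold wt
  gcongr
  rw [Real.exp_le_one_iff]
  nlinarith [Real.cos_le_one t]

lemma wt_le_one (t : ℝ) (ht : 0 ≤ t) : wt t ≤ 1 := by
  refine (wt_le t ht).trans ?_
  rw [div_le_one (by positivity)]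
  nlinarith

lemma wt_le_rpow (t : ℝ) (ht : 1 ≤ t) : wt t ≤ t ^ (-1 : ℝ) := by
  refine (wt_le t (by linarith)).trans ?_
  rw [Real.rpow_neg_one, ← one_div]
  gcongr
  nlinarith

lemma wt_ratio (n : ℕ) : wt (((n : ℝ) * (2 * π) + π) + π) / wt ((n : ℝ) * (2 * π) + π)
    ≥ Real.exp ((n : ℝ) * (2 * π) + π) / (5 * ((n : ℝ) * (2 * π) + π) ^ 2) := by
  have h1 : Real.cos ((n : ℝ) * (2 * π) + π) = -1 := by
    rw [Real.cos_add_pi, Real.cos_nat_mul_two_pi]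
  have h2 : Real.cos (((n : ℝ) * (2 * π) + π) + π) = 1 := by
    rw [Real.cos_add_pi, h1]; norm_num
  have hs : π ≤ (n : ℝ) * (2 * π) + π := by
    have : 0 ≤ (n : ℝ) * (2 * π) := by positivity
    linarith
  unfold wt
  rw [h1, h2]
  generalize (n : ℝ) * (2 * π) + π = s at *
  have hpi := Real.pi_gt_three
  have e : Real.exp (-((s + π) * (1 - 1))) / ((s + π) ^ 2 + 1) /
      (Real.exp (-(s * (1 - -1))) / (s ^ 2 + 1))
      = Real.exp (s * 2) * (s ^ 2 + 1) / ((s + π) ^ 2 + 1) := by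
    rw [Real.exp_neg (s * (1 - -1))]
    norm_num
    field_simp
  rw [e, ge_iff_le]
  apply div_le_div₀ (by positivity)
  · have : Real.exp s ≤ Real.exp (s * 2) := Real.exp_le_exp.2 (by linarith)
    nlinarith [Real.exp_pos (s * 2), mul_nonneg (Real.exp_pos (s * 2)).le (sq_nonneg s)]
  · positivity
  · nlinarith

/-- there is a skew-evolution semiflow on `X × ℝ²` (with the `ℓ¹` norm) that is polynomially dichotomic but not Barreira-Valls polynomially dichotomic. -/
theorem exists_polyDichotomic_not_bvPolyDichotomic :
    ∃ (X : Type) (_ : MetricSpace X)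
      (φ : ℝ → ℝ → X → X)
      (Φ : ℝ → ℝ → X → (WithLp 1 (ℝ × ℝ) →L[ℝ] WithLp 1 (ℝ × ℝ)))
      (P₁ P₂ : X → (WithLp 1 (ℝ × ℝ) →L[ℝ] WithLp 1 (ℝ × ℝ))),
      IsSkewEvolutionSemiflow φ Φ ∧ CompatibleProjectors φ Φ P₁ P₂ ∧
      IsPolyDichotomic Φ P₁ P₂ ∧ ¬ IsBVPolyDichotomic Φ P₁ P₂ := by
  refine ⟨Unit, inferInstance, fun _ _ x => x, fun t s _ => diagOp (wt t / wt s) (wt s / wt t),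
    fun _ => diagOp 1 0, fun _ => diagOp 0 1, ⟨⟨?_, ?_⟩, ?_, ?_⟩, ⟨?_, ⟨⟨?_, ?_⟩, ?_⟩, ⟨?_, ?_⟩, ?_⟩,
    ?_, ?_⟩
  · intros; rfl
  · intros; rfl
  · intro t x _
    simp only [div_self (wt_pos t).ne', diagOp_one]
  · intro t s t₀ x _ _ _
    have := (wt_pos s).ne'
    have := (wt_pos t).ne'
    have := (wt_pos t₀).ne'
    simp only [diagOp_comp]
    congr 1 <;> field_simp
  · intro x; exact diagOp_sub
  · intro x; simp [diagOp_comp]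
  · exact (diagOp 1 0).continuous.comp continuous_snd
  · intros; simp [diagOp_comp]
  · intro x; simp [diagOp_comp]
  · exact (diagOp 0 1).continuous.comp continuous_snd
  · intros; simp [diagOp_comp]
  · refine ⟨fun s => 1 / wt s, 1, 1, ?_, one_pos, one_pos, ?_⟩
    · intro s hs
      rw [le_div_iff₀ (wt_pos s), one_mul]
      exact wt_le_one s hs
    · intro t s x v hs hst
      have h1 := wt_le_rpow t (hs.trans hst)
      have p := wt_pos s
      have q := wt_pos t
      simp only [← ContinuousLinearMap.comp_apply, diagOp_comp]
      simp only [norm_diagOp, mul_one, mul_zero, abs_zero, zero_mul, add_zero, zero_add, abs_one,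
        one_mul, abs_of_pos (div_pos p q), abs_of_pos (div_pos q p)]
      constructor
      · rw [div_mul_eq_mul_div 1, one_mul]
        gcongr
      · have : 1 / wt s * t ^ (-1 : ℝ) * (wt s / wt t * |v.snd|)
            = (t ^ (-1 : ℝ) / wt t) * |v.snd| := by field_simp
        rw [this]
        have : 1 ≤ t ^ (-1 : ℝ) / wt t := by rwa [le_div_iff₀ q, one_mul]
        nlinarith [abs_nonneg v.snd]
  · rintro ⟨N, α₁, α₂, β₁, β₂, hN, hα₁, -, -, -, H⟩
    have key : ∀ n : ℕ, Real.exp ((n : ℝ) * (2 * π) + π) ≤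
        (5 * N) * ((n : ℝ) * (2 * π) + π) ^ (β₁ + 2) := by
      intro n
      have hr := wt_ratio n
      have hs : π ≤ (n : ℝ) * (2 * π) + π := by
        have : 0 ≤ (n : ℝ) * (2 * π) := by positivity
        linarith
      generalize (n : ℝ) * (2 * π) + π = s at *
      have hpi := Real.pi_gt_three
      have h := (H (s + π) s () (WithLp.toLp 1 (1, 0)) (by linarith) (by linarith)).1
      simp only [← ContinuousLinearMap.comp_apply, diagOp_comp] at h
      simp only [norm_diagOp, mul_one, mul_zero, abs_zero, add_zero, abs_one, zero_mul, one_mul,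
        WithLp.toLp_fst, WithLp.toLp_snd,
        abs_of_pos (div_pos (wt_pos (s + π)) (wt_pos s))] at h
      have hle : (s + π) ^ (-α₁) ≤ 1 :=
        Real.rpow_le_one_of_one_le_of_nonpos (by linarith) (by linarith)
      have hsp : 0 < s := by linarith
      have hb : 0 < s ^ β₁ := Real.rpow_pos_of_pos hsp _
      have h3 : N * (s + π) ^ (-α₁) * s ^ β₁ ≤ N * 1 * s ^ β₁ := by gcongr
      have h4 := (hr.le.trans h).trans h3
      rw [div_le_iff₀ (by positivity)] at h4
      rw [Real.rpow_add hsp, Real.rpow_two]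
      linarith
    have ht : Filter.Tendsto (fun n : ℕ => (n : ℝ) * (2 * π) + π) Filter.atTop Filter.atTop :=
      Filter.tendsto_atTop_add_const_right _ _
        (tendsto_natCast_atTop_atTop.atTop_mul_const (by positivity))
    have ho := (isLittleO_rpow_exp_atTop (β₁ + 2)).comp_tendsto ht
    have hc : (0 : ℝ) < 1 / (10 * N) := by positivity
    obtain ⟨n, hn⟩ := (ho.def hc).exists
    have hk := key n
    simp only [Function.comp] at hn
    rw [Real.norm_eq_abs, Real.norm_eq_abs, Real.abs_exp] at hn
    have h5 := (le_abs_self _).trans hn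
    have h6 := mul_le_mul_of_nonneg_left h5 (by positivity : 0 ≤ 5 * N)
    have h7 : 5 * N * (1 / (10 * N) * Real.exp ((n : ℝ) * (2 * π) + π))
        = Real.exp ((n : ℝ) * (2 * π) + π) / 2 := by field_simp; norm_num
    rw [h7] at h6
    linarith [Real.exp_pos ((n : ℝ) * (2 * π) + π)]
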